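/- For every complex number s with Re(s) > 0, ∫₀¹ ν(1/x)·x^(s−1) dx = η(s)/s, where η is the Dirichlet eta function. -/

import Mathlib

open MeasureTheory

noncomputable def nu (x : ℝ) : ℝ := 2 * Int.fract (x / 2) - Int.fract x

noncomputable def eta (s : ℂ) : ℂ :=
  ∑' k : ℕ, ((2 * ((k : ℂ) + 1) - 1) ^ (-s) - (2 * ((k : ℂ) + 1)) ^ (-s))

lemma nu_eq (y : ℝ) : nu y = ((⌊y⌋ % 2 : ℤ) : ℝ) := by
  have h : ⌊y / 2⌋ = ⌊y⌋ / 2 := by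
    have := Int.floor_div_natCast y 2
    simpa using this
  unfold nu
  rw [Int.fract, Int.fract, h, Int.emod_def]
  push_cast
  ring

lemma mem_A {x : ℝ} (hx : 0 < x) (k : ℕ) :
    x ∈ Set.Ioc (1 / (2 * (k : ℝ) + 2)) (1 / (2 * (k : ℝ) + 1)) ↔ ⌊1 / x⌋ = 2 * (k : ℤ) + 1 := by
  have h1 : (0 : ℝ) < 2 * (k : ℝ) + 2 := by positivity
  have h2 : (0 : ℝ) < 2 * (k : ℝ) + 1 := by positivity
  rw [Int.floor_eq_iff, Set.mem_Ioc, one_div_lt h1 hx, le_one_div hx h2]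
  push_cast
  rw [show 2 * (k : ℝ) + 1 + 1 = 2 * k + 2 by ring]
  tauto

lemma nu_ind {x : ℝ} (hx : 0 < x) (g : ℝ → ℂ) :
    (nu (1 / x) : ℂ) * g x =
      (⋃ k : ℕ, Set.Ioc (1 / (2 * (k : ℝ) + 2)) (1 / (2 * (k : ℝ) + 1))).indicator g x := by
  rw [nu_eq]
  by_cases h : x ∈ ⋃ k : ℕ, Set.Ioc (1 / (2 * (k : ℝ) + 2)) (1 / (2 * (k : ℝ) + 1))
  · rw [Set.indicator_of_mem h]
    obtain ⟨k, hk⟩ := Set.mem_iUnion.1 h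
    rw [mem_A hx] at hk
    rw [hk, show (2 * (k : ℤ) + 1) % 2 = 1 by omega]
    simp
  · rw [Set.indicator_of_notMem h]
    have h0 : 0 ≤ ⌊1 / x⌋ := Int.floor_nonneg.2 (by positivity)
    have : ⌊1 / x⌋ % 2 = 0 := by
      by_contra h3
      apply h
      refine Set.mem_iUnion.2 ⟨(⌊1 / x⌋ / 2).toNat, ?_⟩
      rw [mem_A hx]
      omega
    rw [this]
    simp

lemma int_A {s : ℂ} (hs : 0 < s.re) (k : ℕ) :
    ∫ x in Set.Ioc (1 / (2 * (k : ℝ) + 2)) (1 / (2 * (k : ℝ) + 1)), (x : ℂ) ^ (s - 1) =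
      ((2 * ((k : ℂ) + 1) - 1) ^ (-s) - (2 * ((k : ℂ) + 1)) ^ (-s)) / s := by
  have key : ∀ a : ℝ, 0 < a → ((1 / a : ℝ) : ℂ) ^ s = (a : ℂ) ^ (-s) := by
    intro a ha
    rw [one_div, Complex.ofReal_inv, Complex.inv_cpow, Complex.cpow_neg]
    rw [Complex.arg_ofReal_of_nonneg ha.le]
    exact Real.pi_pos.ne
  rw [← intervalIntegral.integral_of_le (by gcongr; norm_num),
    integral_cpow (Or.inl (by simpa using hs)), sub_add_cancel,
    key _ (by positivity), key _ (by positivity)]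
  push_cast
  ring_nf

theorem stmt_5 : ∀ s : ℂ, 0 < s.re →
    ∫ x in Set.Ioo (0 : ℝ) 1, (nu (1 / x) : ℂ) * (x : ℂ) ^ (s - 1) = eta s / s := by
  intro s hs
  set A : ℕ → Set ℝ := fun k => Set.Ioc (1 / (2 * (k : ℝ) + 2)) (1 / (2 * (k : ℝ) + 1)) with hA
  have hsub : (⋃ k, A k) ⊆ Set.Ioc 0 1 := by
    refine Set.iUnion_subset fun k x hx => ⟨lt_trans (by positivity) hx.1, hx.2.trans ?_⟩
    rw [div_le_one (by positivity)]
    have : (0 : ℝ) ≤ k := by positivity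
    linarith
  have hm : ∀ k, MeasurableSet (A k) := fun k => measurableSet_Ioc
  have hint : IntegrableOn (fun x : ℝ => (x : ℂ) ^ (s - 1)) (⋃ k, A k) := by
    refine IntegrableOn.mono_set ?_ hsub
    rw [← intervalIntegrable_iff_integrableOn_Ioc_of_le zero_le_one]
    exact intervalIntegral.intervalIntegrable_cpow' (by simpa using hs)
  have hd : Pairwise (Function.onFun Disjoint A) := by
    intro i j hij
    refine Set.disjoint_left.2 fun x hi hj => hij ?_
    have hx : 0 < x := lt_trans (by positivity) hi.1
    have h1 := (mem_A hx i).1 hi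
    have h2 := (mem_A hx j).1 hj
    omega
  rw [← integral_Ioc_eq_integral_Ioo,
    setIntegral_congr_fun measurableSet_Ioc
      (fun x hx => nu_ind hx.1 (fun x : ℝ => (x : ℂ) ^ (s - 1))),
    setIntegral_indicator (MeasurableSet.iUnion hm), Set.inter_eq_right.2 hsub,
    integral_iUnion hm hd hint]
  simp only [hA, int_A hs]
  rw [tsum_div_const, eta]
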